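/- arXiv:2505.13893 — 7 statements merged into one kernel-verified Lean document; each statement's English description precedes it below -/
import Mathlib

section
/- Let n, m be positive integers and let C ∈ ℝ^{n×n} and D ∈ ℝ^{m×m} be real matrices. Let A = Σ_{i,j,k,l} (C(i,j) − D(k,l))² and B = Σ_{i,j,k,l} (f_C(i) − f_D(k))(f_C(j) − f_D(l)), where f_C(i) = (1/n) Σ_j C(i,j) and f_D(k) = (1/m) Σ_l D(k,l), and where the quadruple sums range over i,j ∈ {1,…,n} and k,l ∈ {1,…,m}. Let Σ_C² = (1/n²) Σ_{i,j} (C(i,j) − μ_C)² and Σ_D² = (1/m²) Σ_{k,l} (D(k,l) − μ_D)² be the global variances, where μ_C, μ_D are the global means. Then A − B = n² m² (Σ_C² + Σ_D²). -/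
open Finset in
lemma sum_sum_sub_sq {ι κ : Type*} [Fintype ι] [Fintype κ] (x : ι → ℝ) (y : κ → ℝ) :
    ∑ i, ∑ k, (x i - y k) ^ 2 =
      Fintype.card κ * ∑ i, x i ^ 2 - 2 * (∑ i, x i) * ∑ k, y k
        + Fintype.card ι * ∑ k, y k ^ 2 := by
  simp only [sub_sq, sum_add_distrib, sum_sub_distrib, ← mul_sum, ← sum_mul, sum_const,
    card_univ, nsmul_eq_mul]

open Finset in
lemma sum_sum_sum_sum_sub_mul_sub {ι κ : Type*} [Fintype ι] [Fintype κ]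
    (f : ι → ℝ) (g : κ → ℝ) :
    ∑ i, ∑ j, ∑ k, ∑ l, (f i - g k) * (f j - g l) =
      (Fintype.card κ * ∑ i, f i - Fintype.card ι * ∑ k, g k) ^ 2 := by
  simp only [← mul_sum, ← sum_mul, sum_sub_distrib, sum_const, card_univ, nsmul_eq_mul]
  rw [pow_two]

open Finset in
lemma sum_sub_const_sq {ι : Type*} [Fintype ι] (x : ι → ℝ) (c : ℝ) :
    ∑ i, (x i - c) ^ 2 = ∑ i, x i ^ 2 - 2 * c * ∑ i, x i + Fintype.card ι * c ^ 2 := by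
  simp only [sub_sq, sum_add_distrib, sum_sub_distrib, ← mul_sum, ← sum_mul, sum_const,
    card_univ, nsmul_eq_mul]
  ring


/-- With
`A = Σ_{i,j,k,l} (C(i,j) − D(k,l))²`,
`B = Σ_{i,j,k,l} (f_C(i) − f_D(k))(f_C(j) − f_D(l))`,
and global variances `Σ_C², Σ_D²`, one has `A − B = n² m² (Σ_C² + Σ_D²)`. -/
theorem quadruple_sum_diff_eq_variances (n m : ℕ) (hn : 0 < n) (hm : 0 < m)
    (C : Matrix (Fin n) (Fin n) ℝ) (D : Matrix (Fin m) (Fin m) ℝ) :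
    (∑ i : Fin n, ∑ j : Fin n, ∑ k : Fin m, ∑ l : Fin m, (C i j - D k l) ^ 2)
      - (∑ i : Fin n, ∑ j : Fin n, ∑ k : Fin m, ∑ l : Fin m,
          (((1 / (n : ℝ)) * ∑ j' : Fin n, C i j') - ((1 / (m : ℝ)) * ∑ l' : Fin m, D k l'))
            * (((1 / (n : ℝ)) * ∑ j' : Fin n, C j j') - ((1 / (m : ℝ)) * ∑ l' : Fin m, D l l'))) =
      (n : ℝ) ^ 2 * (m : ℝ) ^ 2 *
        (((1 / (n : ℝ) ^ 2) * ∑ i : Fin n, ∑ j : Fin n,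
            (C i j - (1 / (n : ℝ) ^ 2) * ∑ i' : Fin n, ∑ j' : Fin n, C i' j') ^ 2)
          + ((1 / (m : ℝ) ^ 2) * ∑ k : Fin m, ∑ l : Fin m,
            (D k l - (1 / (m : ℝ) ^ 2) * ∑ k' : Fin m, ∑ l' : Fin m, D k' l') ^ 2)) := by
  have hn' : (n : ℝ) ≠ 0 := by positivity
  have hm' : (m : ℝ) ≠ 0 := by positivity
  have hA := sum_sum_sub_sq (fun p : Fin n × Fin n => C p.1 p.2)
    (fun q : Fin m × Fin m => D q.1 q.2)
  have hC (c : ℝ) := sum_sub_const_sq (fun p : Fin n × Fin n => C p.1 p.2) c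
  have hD (c : ℝ) := sum_sub_const_sq (fun q : Fin m × Fin m => D q.1 q.2) c
  simp only [Fintype.sum_prod_type, Fintype.card_prod, Fintype.card_fin, Nat.cast_mul]
    at hA hC hD
  rw [hA, sum_sum_sum_sum_sub_mul_sub (fun i => 1 / (n : ℝ) * ∑ j, C i j)
    (fun k => 1 / (m : ℝ) * ∑ l, D k l), hC, hD]
  simp only [← Finset.mul_sum, Fintype.card_fin]
  field_simp
  ring
end

section
/- (Proposition 1, approximation error bound.) Let n, m be positive integers and let C ∈ ℝ^{n×n}, D ∈ ℝ^{m×m} have nonnegative entries with each row summing to 1. Under the uniform transport plan γ_{ik} = 1/(nm), define GW(C,D) = (1/(n²m²)) Σ_{i,j,k,l} (C(i,j) − D(k,l))² and the approximation G̃W(C,D) = (1/(n²m²)) Σ_{i,j,k,l} (f_C(i) − f_D(k))(f_C(j) − f_D(l)), where f_C(i) = (1/n) Σ_j C(i,j), f_D(k) = (1/m) Σ_l D(k,l), and the quadruple sums range over i,j ∈ {1,…,n} and k,l ∈ {1,…,m}. Then |GW(C,D) − G̃W(C,D)| ≤ (n − 1)/n² + (m − 1)/m². -/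
/-- The sum of squares of the entries of an `n × n` row-stochastic matrix lies in `[1, n]`. -/
theorem sum_sq_mem_Icc_of_rowStochastic {n : ℕ} (hn : 0 < n) (C : Matrix (Fin n) (Fin n) ℝ)
    (hC : ∀ i j, 0 ≤ C i j) (hCrow : ∀ i, ∑ j, C i j = 1) :
    ∑ i, ∑ j, C i j ^ 2 ∈ Set.Icc (1 : ℝ) n := by
  have hn' : (0 : ℝ) < n := by exact_mod_cast hn
  constructor
  · have row (i : Fin n) : 1 / (n : ℝ) ≤ ∑ j, C i j ^ 2 := by
      rw [div_le_iff₀ hn', mul_comm]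
      simpa [hCrow i] using sq_sum_le_card_mul_sum_sq (s := Finset.univ) (f := C i)
    have h := Finset.sum_le_sum fun i (_ : i ∈ Finset.univ) => row i
    simpa [hn'.ne'] using h
  · have row (i : Fin n) : ∑ j, C i j ^ 2 ≤ 1 := by
      simpa [hCrow i] using Finset.sum_sq_le_sq_sum_of_nonneg
        (s := Finset.univ) (f := C i) fun j _ => hC i j
    have h := Finset.sum_le_sum fun i (_ : i ∈ Finset.univ) => row i
    simpa using h

/-- The sum of squared entrywise differences of two row-stochastic matrices. -/
theorem sum_sub_sq_of_row_sum_eq_one {n m : ℕ} (C : Matrix (Fin n) (Fin n) ℝ)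
    (D : Matrix (Fin m) (Fin m) ℝ) (hCrow : ∀ i, ∑ j, C i j = 1) (hDrow : ∀ k, ∑ l, D k l = 1) :
    ∑ i, ∑ j, ∑ k, ∑ l, (C i j - D k l) ^ 2
      = (m : ℝ) ^ 2 * ∑ i, ∑ j, C i j ^ 2 + (n : ℝ) ^ 2 * ∑ k, ∑ l, D k l ^ 2 - 2 * n * m := by
  have inner (c : ℝ) : ∑ k, ∑ l, (c - D k l) ^ 2
      = (m : ℝ) ^ 2 * c ^ 2 - 2 * m * c + ∑ k, ∑ l, D k l ^ 2 := by
    simp only [sub_sq, Finset.sum_add_distrib, Finset.sum_sub_distrib, ← Finset.mul_sum, hDrow,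
      Finset.sum_const, Finset.card_univ, Fintype.card_fin, nsmul_eq_mul]
    ring
  simp only [inner, Finset.sum_add_distrib, Finset.sum_sub_distrib, ← Finset.mul_sum, hCrow,
    Finset.sum_const, Finset.card_univ, Fintype.card_fin, nsmul_eq_mul]
  ring


/-- **Proposition 1, approximation error bound.**
For row-stochastic `C ∈ ℝ^{n×n}`, `D ∈ ℝ^{m×m}`, with
`GW(C,D) = (1/(n²m²)) Σ_{i,j,k,l} (C(i,j) − D(k,l))²` and
`G̃W(C,D) = (1/(n²m²)) Σ_{i,j,k,l} (f_C(i) − f_D(k))(f_C(j) − f_D(l))`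
(under the uniform transport plan `γ_{ik} = 1/(nm)`),
`|GW(C,D) − G̃W(C,D)| ≤ (n − 1)/n² + (m − 1)/m²`. -/
theorem gw_approximation_error_bound (n m : ℕ) (hn : 0 < n) (hm : 0 < m)
    (C : Matrix (Fin n) (Fin n) ℝ) (D : Matrix (Fin m) (Fin m) ℝ)
    (hC : ∀ i j, 0 ≤ C i j) (hCrow : ∀ i, ∑ j, C i j = 1)
    (hD : ∀ k l, 0 ≤ D k l) (hDrow : ∀ k, ∑ l, D k l = 1) :
    |(1 / ((n : ℝ) ^ 2 * (m : ℝ) ^ 2)) *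
        (∑ i : Fin n, ∑ j : Fin n, ∑ k : Fin m, ∑ l : Fin m, (C i j - D k l) ^ 2)
      - (1 / ((n : ℝ) ^ 2 * (m : ℝ) ^ 2)) *
        (∑ i : Fin n, ∑ j : Fin n, ∑ k : Fin m, ∑ l : Fin m,
          (((1 / (n : ℝ)) * ∑ j' : Fin n, C i j') - ((1 / (m : ℝ)) * ∑ l' : Fin m, D k l'))
            * (((1 / (n : ℝ)) * ∑ j' : Fin n, C j j') - ((1 / (m : ℝ)) * ∑ l' : Fin m, D l l')))|
      ≤ ((n : ℝ) - 1) / (n : ℝ) ^ 2 + ((m : ℝ) - 1) / (m : ℝ) ^ 2 := by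
  have hn' : (0 : ℝ) < n := by exact_mod_cast hn
  have hm' : (0 : ℝ) < m := by exact_mod_cast hm
  obtain ⟨hA1, hAn⟩ := sum_sq_mem_Icc_of_rowStochastic hn C hC hCrow
  obtain ⟨hB1, hBm⟩ := sum_sq_mem_Icc_of_rowStochastic hm D hD hDrow
  rw [sum_sub_sq_of_row_sum_eq_one C D hCrow hDrow]
  simp only [hCrow, hDrow, Finset.sum_const, Finset.card_univ, Fintype.card_fin, nsmul_eq_mul]
  set A := ∑ i, ∑ j, C i j ^ 2
  set B := ∑ k, ∑ l, D k l ^ 2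
  have hA : (A - 1) / (n : ℝ) ^ 2 ≤ ((n : ℝ) - 1) / (n : ℝ) ^ 2 := by gcongr
  have hB : (B - 1) / (m : ℝ) ^ 2 ≤ ((m : ℝ) - 1) / (m : ℝ) ^ 2 := by gcongr
  have hA0 : 0 ≤ (A - 1) / (n : ℝ) ^ 2 := div_nonneg (by linarith) (by positivity)
  have hB0 : 0 ≤ (B - 1) / (m : ℝ) ^ 2 := div_nonneg (by linarith) (by positivity)
  calc _ = |(A - 1) / (n : ℝ) ^ 2 + (B - 1) / (m : ℝ) ^ 2| := by
        congr 1
        field_simp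
        ring
    _ ≤ _ := by
        rw [abs_of_nonneg (add_nonneg hA0 hB0)]
        exact add_le_add hA hB
end

section
/- (Coordinate gradient bound for the GW distillation loss.) Let D be a positive integer, λ > 0, R ≥ 0. Let T ∈ ℝ^D satisfy |T_i| ≤ R for all i, and let P ∈ ℝ^{D×D} have nonnegative entries with all row sums and all column sums equal to 1/D. Define L : ℝ^D → ℝ by L(S) = λ Σ_{i,j,k,l} ((T_i − T_j)² − (S_k − S_l)²)² P_{ik} P_{jl}, the sum ranging over i,j,k,l ∈ {1,…,D}. Then for every S ∈ ℝ^D with |S_k| ≤ R for all k and every coordinate p ∈ {1,…,D}, the partial derivative satisfies |∂L/∂S_p (S)| ≤ 64 λ R³ / D. -/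
/-- The derivative of a single summand of the Gromov–Wasserstein loss. -/
lemma hasFDerivAt_gw_summand {ι : Type*} [Fintype ι] (a w v : ℝ) (k l : ι) (S : ι → ℝ) :
    HasFDerivAt (fun S : ι → ℝ => (a - (S k - S l) ^ 2) ^ 2 * w * v)
      ((-4 * (a - (S k - S l) ^ 2) * (S k - S l) * w * v) •
        (ContinuousLinearMap.proj (R := ℝ) (φ := fun _ : ι => ℝ) k -
          ContinuousLinearMap.proj (R := ℝ) (φ := fun _ : ι => ℝ) l)) S := by
  have hu : HasFDerivAt (fun S : ι → ℝ => S k - S l)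
      (ContinuousLinearMap.proj (R := ℝ) (φ := fun _ : ι => ℝ) k -
        ContinuousLinearMap.proj (R := ℝ) (φ := fun _ : ι => ℝ) l) S :=
    (hasFDerivAt_apply k S).sub (hasFDerivAt_apply l S)
  have hg : HasDerivAt (fun u : ℝ => (a - u ^ 2) ^ 2 * w * v)
      (-4 * (a - (S k - S l) ^ 2) * (S k - S l) * w * v) (S k - S l) := by
    have h := (((((hasDerivAt_id (S k - S l)).fun_pow 2).const_sub a).fun_pow 2).mul_const
      w).mul_const v
    refine h.congr_deriv ?_
    simp only [id]
    push_cast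
    ring
  exact hg.comp_hasFDerivAt S hu

/-- If the entries of two vectors are bounded by `R`, the derivative of
`u ↦ ((x - y) ^ 2 - u ^ 2) ^ 2` at `u = s - t` is bounded by `32 * R ^ 3`. -/
lemma abs_deriv_gw_cost_le {R x y s t : ℝ} (hx : |x| ≤ R) (hy : |y| ≤ R) (hs : |s| ≤ R)
    (ht : |t| ≤ R) : |-4 * ((x - y) ^ 2 - (s - t) ^ 2) * (s - t)| ≤ 32 * R ^ 3 := by
  have hxy : |x - y| ≤ 2 * R := (abs_sub x y).trans (by linarith)
  have hst : |s - t| ≤ 2 * R := (abs_sub s t).trans (by linarith)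
  have h1 : (x - y) ^ 2 ≤ (2 * R) ^ 2 := sq_le_sq' (abs_le.mp hxy).1 (abs_le.mp hxy).2
  have h2 : (s - t) ^ 2 ≤ (2 * R) ^ 2 := sq_le_sq' (abs_le.mp hst).1 (abs_le.mp hst).2
  have h3 : |(x - y) ^ 2 - (s - t) ^ 2| ≤ (2 * R) ^ 2 :=
    abs_le.mpr ⟨by linarith [sq_nonneg (x - y)], by linarith [sq_nonneg (s - t)]⟩
  calc |-4 * ((x - y) ^ 2 - (s - t) ^ 2) * (s - t)|
      = 4 * (|(x - y) ^ 2 - (s - t) ^ 2| * |s - t|) := by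
        rw [abs_mul, abs_mul, abs_neg, abs_of_pos (by norm_num : (0 : ℝ) < 4), mul_assoc]
    _ ≤ 4 * ((2 * R) ^ 2 * (2 * R)) := by gcongr
    _ = 32 * R ^ 3 := by ring

/-- The total weight that a coupling with uniform marginals gives to the index pairs having
second coordinate `p` in the first or in the second factor. -/
lemma sum_coupling_mul_indicator {D : ℕ} (hD : 0 < D) (P : Matrix (Fin D) (Fin D) ℝ)
    (hProw : ∀ i, ∑ k, P i k = 1 / (D : ℝ)) (hPcol : ∀ k, ∑ i, P i k = 1 / (D : ℝ))
    (p : Fin D) :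
    ∑ i, ∑ j, ∑ k, ∑ l, P i k * P j l *
      ((Pi.single p 1 : Fin D → ℝ) k + (Pi.single p 1 : Fin D → ℝ) l) = 2 / D := by
  have hD' : (D : ℝ) ≠ 0 := by positivity
  have inner (i j : Fin D) : ∑ k, ∑ l, P i k * P j l *
      ((Pi.single p 1 : Fin D → ℝ) k + (Pi.single p 1 : Fin D → ℝ) l) =
        P i p * (1 / D) + 1 / D * P j p := by
    simp only [mul_add, Finset.sum_add_distrib]
    congr 1
    · rw [Finset.sum_eq_single p (by intro k _ hk; simp [hk]) (by simp), ← hProw j,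
        Finset.mul_sum]
      simp
    · rw [← hProw i, Finset.sum_mul]
      refine Finset.sum_congr rfl fun k _ => ?_
      rw [Finset.sum_eq_single p (by intro l _ hl; simp [hl]) (by simp)]
      simp
  simp only [inner, Finset.sum_add_distrib, ← Finset.sum_mul, ← Finset.mul_sum, hPcol,
    Finset.sum_const, Finset.card_univ, Fintype.card_fin, nsmul_eq_mul]
  field_simp
  norm_num

/-- **coordinate gradient bound for the GW distillation loss.**
Let `L(S) = λ Σ_{i,j,k,l} ((T_i − T_j)² − (S_k − S_l)²)² P_{ik} P_{jl}` where `T` has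
entries bounded by `R` and `P` is a coupling with uniform marginals (nonnegative entries,
all row and column sums equal to `1/D`). Then for any `S` with entries bounded by `R` and
any coordinate `p`, `|∂L/∂S_p (S)| ≤ 64 λ R³ / D`. -/
theorem gw_loss_coordinate_gradient_bound (D : ℕ) (hD : 0 < D)
    (lam R : ℝ) (hlam : 0 < lam) (hR : 0 ≤ R)
    (T : Fin D → ℝ) (hT : ∀ i, |T i| ≤ R)
    (P : Matrix (Fin D) (Fin D) ℝ) (hP : ∀ i k, 0 ≤ P i k)
    (hProw : ∀ i, ∑ k, P i k = 1 / (D : ℝ))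
    (hPcol : ∀ k, ∑ i, P i k = 1 / (D : ℝ))
    (S : Fin D → ℝ) (hS : ∀ k, |S k| ≤ R) (p : Fin D) :
    |fderiv ℝ
        (fun S : Fin D → ℝ =>
          lam * ∑ i : Fin D, ∑ j : Fin D, ∑ k : Fin D, ∑ l : Fin D,
            ((T i - T j) ^ 2 - (S k - S l) ^ 2) ^ 2 * P i k * P j l)
        S (Pi.single p 1)|
      ≤ 64 * lam * R ^ 3 / D := by
  have hderiv := (HasFDerivAt.fun_sum (u := Finset.univ) fun i _ =>
    HasFDerivAt.fun_sum (u := Finset.univ) fun j _ =>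
    HasFDerivAt.fun_sum (u := Finset.univ) fun k _ =>
    HasFDerivAt.fun_sum (u := Finset.univ) fun l _ =>
      hasFDerivAt_gw_summand ((T i - T j) ^ 2) (P i k) (P j l) k l S).const_mul lam
  rw [hderiv.fderiv]
  simp only [smul_apply, sum_apply, sub_apply, ContinuousLinearMap.proj_apply, smul_eq_mul]
  set e : Fin D → ℝ := Pi.single p 1
  have he0 (k : Fin D) : 0 ≤ e k := (Pi.single_nonneg.mpr zero_le_one : 0 ≤ e) k
  have hterm (i j k l : Fin D) :
      |-4 * ((T i - T j) ^ 2 - (S k - S l) ^ 2) * (S k - S l) * P i k * P j l * (e k - e l)| ≤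
        32 * R ^ 3 * (P i k * P j l * (e k + e l)) := by
    have hw : 0 ≤ P i k * P j l := mul_nonneg (hP i k) (hP j l)
    have hsub : |e k - e l| ≤ e k + e l :=
      abs_le.mpr ⟨by linarith [he0 k], by linarith [he0 l]⟩
    rw [mul_assoc _ (P i k), mul_assoc _ (P i k * P j l), abs_mul,
      abs_mul (P i k * P j l), abs_of_nonneg hw]
    have := abs_deriv_gw_cost_le (hT i) (hT j) (hS k) (hS l)
    gcongr
  rw [abs_mul, abs_of_pos hlam]
  calc _ ≤ lam * ∑ i, ∑ j, ∑ k, ∑ l, 32 * R ^ 3 * (P i k * P j l * (e k + e l)) := by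
        gcongr
        refine (Finset.abs_sum_le_sum_abs _ _).trans (Finset.sum_le_sum fun i _ => ?_)
        refine (Finset.abs_sum_le_sum_abs _ _).trans (Finset.sum_le_sum fun j _ => ?_)
        refine (Finset.abs_sum_le_sum_abs _ _).trans (Finset.sum_le_sum fun k _ => ?_)
        exact (Finset.abs_sum_le_sum_abs _ _).trans (Finset.sum_le_sum fun l _ => hterm i j k l)
    _ = lam * (32 * R ^ 3 * (2 / D)) := by
        simp only [← Finset.mul_sum]
        rw [sum_coupling_mul_indicator hD P hProw hPcol p]
    _ = 64 * lam * R ^ 3 / D := by ring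
end

section
/- Let p ∈ ℝ^D be a probability vector (nonnegative entries summing to 1) and let J ∈ ℝ^{D×D} be the softmax Jacobian matrix J_{ij} = p_i(δ_{ij} − p_j), i.e., J = diag(p) − p pᵀ. Then for every row index i, the Euclidean norm of the i-th row satisfies √(Σ_{j=1}^D p_i²(δ_{ij} − p_j)²) ≤ 1/2. -/
/-- For a probability vector `p ∈ ℝ^D` and the softmax Jacobian
`J_{ij} = p_i(δ_{ij} − p_j)`, every row of `J` has Euclidean norm at most `1/2`:
`√(Σ_j p_i²(δ_{ij} − p_j)²) ≤ 1/2`. -/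
theorem softmax_jacobian_row_norm_bound (D : ℕ) (p : Fin D → ℝ)
    (hp : ∀ i, 0 ≤ p i) (hsum : ∑ i, p i = 1) :
    ∀ i, Real.sqrt (∑ j, (p i) ^ 2 * ((if i = j then (1 : ℝ) else 0) - p j) ^ 2)
      ≤ 1 / 2 := by
  intro i
  have herase : p i + ∑ j ∈ Finset.univ.erase i, p j = 1 := by
    rw [Finset.add_sum_erase _ _ (Finset.mem_univ i), hsum]
  have hrest : ∑ j ∈ Finset.univ.erase i, p j = 1 - p i := by linarith
  have hoff : ∑ j ∈ Finset.univ.erase i, p j ^ 2 ≤ (1 - p i) ^ 2 := by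
    rw [← hrest]
    exact Finset.sum_sq_le_sq_sum_of_nonneg fun j _ => hp j
  have hrow : ∑ j, p i ^ 2 * ((if i = j then (1 : ℝ) else 0) - p j) ^ 2
      = p i ^ 2 * ((1 - p i) ^ 2 + ∑ j ∈ Finset.univ.erase i, p j ^ 2) := by
    rw [← Finset.mul_sum, ← Finset.add_sum_erase _ _ (Finset.mem_univ i), if_pos rfl]
    congr 2
    refine Finset.sum_congr rfl fun j hj => ?_
    rw [if_neg (Finset.ne_of_mem_erase hj).symm, zero_sub, neg_sq]
  have hle : p i ≤ 1 := by
    linarith [Finset.sum_nonneg fun j (_ : j ∈ Finset.univ.erase i) => hp j]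
  have hprod : p i * (1 - p i) ≤ 1 / 4 := by nlinarith [sq_nonneg (p i - 1 / 2)]
  have hprod_nonneg : 0 ≤ p i * (1 - p i) := mul_nonneg (hp i) (by linarith)
  rw [Real.sqrt_le_left (by norm_num), hrow]
  nlinarith [mul_le_mul_of_nonneg_left hoff (sq_nonneg (p i))]
end

section
/- Let p ∈ ℝ^D be a probability vector (nonnegative entries summing to 1). Then the symmetric matrix J = diag(p) − p pᵀ is positive semidefinite and its ℓ²→ℓ² operator norm satisfies ‖J‖ ≤ 1/2. -/
/-- The quadratic form of `diag(p) − p pᵀ` is the variance functional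
`x ↦ ∑ pᵢ xᵢ² − (∑ pᵢ xᵢ)²`. -/
theorem dotProduct_diagonal_sub_vecMulVec_mulVec {ι : Type*} [Fintype ι] [DecidableEq ι]
    (p x : ι → ℝ) :
    x ⬝ᵥ ((Matrix.diagonal p - Matrix.vecMulVec p p).mulVec x) =
      ∑ i, p i * x i ^ 2 - (∑ i, p i * x i) ^ 2 := by
  rw [Matrix.sub_mulVec, dotProduct_sub, Matrix.vecMulVec_mulVec]
  congr 1
  · simp only [dotProduct, Matrix.mulVec_diagonal]
    exact Finset.sum_congr rfl fun i _ => by ring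
  · simp only [dotProduct, Pi.smul_apply, MulOpposite.smul_eq_mul_unop, MulOpposite.unop_op]
    rw [sq, Finset.sum_mul]
    exact Finset.sum_congr rfl fun i _ => by ring

/-- The variance with respect to a probability vector is nonnegative. -/
theorem sq_sum_mul_le_sum_mul_sq {ι : Type*} [Fintype ι] {p : ι → ℝ}
    (hp : ∀ i, 0 ≤ p i) (hsum : ∑ i, p i = 1) (x : ι → ℝ) :
    (∑ i, p i * x i) ^ 2 ≤ ∑ i, p i * x i ^ 2 :=
  Real.pow_arith_mean_le_arith_mean_pow_of_even Finset.univ p x (fun i _ => hp i) hsum even_two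

/-- The variance of `x` with respect to a probability vector is at most `‖x‖₂² / 2`. -/
theorem sum_mul_sq_sub_sq_sum_mul_le {ι : Type*} [Fintype ι] {p : ι → ℝ}
    (hp : ∀ i, 0 ≤ p i) (hsum : ∑ i, p i = 1) (x : ι → ℝ) :
    ∑ i, p i * x i ^ 2 - (∑ i, p i * x i) ^ 2 ≤ 1 / 2 * ∑ i, x i ^ 2 := by
  have expand : ∑ i, p i * ∑ j, p j * (x i + x j) ^ 2 =
      2 * ∑ i, p i * x i ^ 2 + 2 * (∑ i, p i * x i) ^ 2 := by
    have inner_sum (i : ι) : ∑ j, p j * (x i + x j) ^ 2 =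
        x i ^ 2 + 2 * x i * (∑ j, p j * x j) + ∑ j, p j * x j ^ 2 := by
      calc ∑ j, p j * (x i + x j) ^ 2
          = ∑ j, (p j * x i ^ 2 + 2 * x i * (p j * x j) + p j * x j ^ 2) :=
            Finset.sum_congr rfl fun j _ => by ring
        _ = _ := by
          rw [Finset.sum_add_distrib, Finset.sum_add_distrib, ← Finset.sum_mul,
            ← Finset.mul_sum, hsum, one_mul]
    simp only [inner_sum]
    calc ∑ i, p i * (x i ^ 2 + 2 * x i * (∑ j, p j * x j) + ∑ j, p j * x j ^ 2)
        = ∑ i, (p i * x i ^ 2 + p i * x i * (2 * ∑ j, p j * x j) +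
            p i * ∑ j, p j * x j ^ 2) := Finset.sum_congr rfl fun i _ => by ring
      _ = _ := by
        rw [Finset.sum_add_distrib, Finset.sum_add_distrib, ← Finset.sum_mul,
          ← Finset.sum_mul, hsum]
        ring
  have diag_le : ∑ i, 4 * (p i ^ 2 * x i ^ 2) ≤ ∑ i, p i * ∑ j, p j * (x i + x j) ^ 2 := by
    refine Finset.sum_le_sum fun i _ => ?_
    have := Finset.single_le_sum (f := fun j => p j * (x i + x j) ^ 2)
      (fun j _ => mul_nonneg (hp j) (sq_nonneg _)) (Finset.mem_univ i)
    calc 4 * (p i ^ 2 * x i ^ 2) = p i * (p i * (x i + x i) ^ 2) := by ring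
      _ ≤ _ := mul_le_mul_of_nonneg_left this (hp i)
  have pointwise : ∑ i, (2 * (p i * x i ^ 2) - 1 / 2 * x i ^ 2) ≤
      ∑ i, 2 * (p i ^ 2 * x i ^ 2) :=
    Finset.sum_le_sum fun i _ => by
      nlinarith [mul_nonneg (sq_nonneg (2 * p i - 1)) (sq_nonneg (x i))]
  rw [Finset.sum_sub_distrib] at pointwise
  simp only [← Finset.mul_sum] at *
  linarith

/-- For a probability vector `p ∈ ℝ^D`, the symmetric matrix
`J = diag(p) − p pᵀ` is positive semidefinite and its `ℓ²→ℓ²` operator norm is at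
most `1/2`. -/
theorem softmax_jacobian_psd_and_norm (D : ℕ) (p : Fin D → ℝ)
    (hp : ∀ i, 0 ≤ p i) (hsum : ∑ i, p i = 1) :
    (Matrix.diagonal p - Matrix.vecMulVec p p).PosSemidef ∧
    ‖LinearMap.toContinuousLinearMap
        (Matrix.toEuclideanLin (Matrix.diagonal p - Matrix.vecMulVec p p))‖ ≤ 1 / 2 := by
  have psd : (Matrix.diagonal p - Matrix.vecMulVec p p).PosSemidef := by
    refine Matrix.PosSemidef.of_dotProduct_mulVec_nonneg ?_ fun x => ?_
    · rw [Matrix.IsHermitian, Matrix.conjTranspose_sub, Matrix.diagonal_conjTranspose,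
        Matrix.conjTranspose_vecMulVec, star_trivial]
    · rw [star_trivial, dotProduct_diagonal_sub_vecMulVec_mulVec]
      exact sub_nonneg.mpr (sq_sum_mul_le_sum_mul_sq hp hsum x)
  refine ⟨psd, ?_⟩
  rw [ContinuousLinearMap.norm_eq_iSup_rayleighQuotient]
  · refine ciSup_le fun x => ?_
    have form : ContinuousLinearMap.reApplyInnerSelf (LinearMap.toContinuousLinearMap
        (Matrix.toEuclideanLin (Matrix.diagonal p - Matrix.vecMulVec p p))) x =
        ∑ i, p i * x i ^ 2 - (∑ i, p i * x i) ^ 2 := by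
      rw [← dotProduct_diagonal_sub_vecMulVec_mulVec p x.ofLp]
      simp [ContinuousLinearMap.reApplyInnerSelf_apply, EuclideanSpace.inner_eq_star_dotProduct,
        Matrix.sub_mulVec, dotProduct_sub]
    rw [ContinuousLinearMap.rayleighQuotient, form, abs_of_nonneg (div_nonneg
      (sub_nonneg.mpr (sq_sum_mul_le_sum_mul_sq hp hsum x)) (sq_nonneg _)),
      EuclideanSpace.real_norm_sq_eq]
    exact div_le_of_le_mul₀ (Finset.sum_nonneg fun i _ => sq_nonneg _) (by norm_num)
      (sum_mul_sq_sub_sq_sum_mul_le hp hsum x)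
  · exact Matrix.isSymmetric_toEuclideanLin_iff.mpr psd.isHermitian
end

section
/- (Core bound in the Lipschitz constant of the 1-Wasserstein loss.) Let p ∈ ℝ^D be a probability vector (nonnegative entries summing to 1), let Δ ≥ 0, and let φ ∈ ℝ^D satisfy |φ_i| ≤ Δ for all i. Then ‖(diag(p) − p pᵀ) φ‖₂ ≤ Δ √D / 2, where ‖·‖₂ is the Euclidean norm. -/
/-- The softmax Jacobian acts by centering at the `p`-mean and rescaling by `p`. -/
lemma softmax_jacobian_mulVec_apply {ι : Type*} [Fintype ι] [DecidableEq ι] (p φ : ι → ℝ)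
    (i : ι) :
    (Matrix.diagonal p - Matrix.vecMulVec p p).mulVec φ i = p i * (φ i - ∑ j, p j * φ j) := by
  rw [Matrix.sub_mulVec, Pi.sub_apply, Matrix.mulVec_diagonal, mul_sub, Finset.mul_sum]
  simp [Matrix.mulVec, dotProduct, Matrix.vecMulVec_apply, mul_assoc]

/-- A bounded function deviates from its `p`-mean at `i` by at most `2 * Δ * (1 - p i)`. -/
lemma abs_sub_mean_le {ι : Type*} [Fintype ι] [DecidableEq ι] {p φ : ι → ℝ} {Δ : ℝ}
    (hp : ∀ i, 0 ≤ p i) (hsum : ∑ i, p i = 1) (hφ : ∀ i, |φ i| ≤ Δ) (i : ι) :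
    |φ i - ∑ j, p j * φ j| ≤ 2 * Δ * (1 - p i) := by
  have h_sum : φ i - ∑ j, p j * φ j = ∑ j ∈ Finset.univ.erase i, p j * (φ i - φ j) := by
    rw [Finset.sum_erase _ (by simp)]
    simp [mul_sub, ← Finset.sum_mul, hsum]
  have h_erase : ∑ j ∈ Finset.univ.erase i, p j = 1 - p i := by
    rw [← hsum, ← Finset.add_sum_erase _ p (Finset.mem_univ i), add_sub_cancel_left]
  rw [h_sum, ← h_erase, Finset.mul_sum]
  refine (Finset.abs_sum_le_sum_abs _ _).trans (Finset.sum_le_sum fun j _ => ?_)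
  rw [abs_mul, abs_of_nonneg (hp j), mul_comm]
  refine mul_le_mul_of_nonneg_right ?_ (hp j)
  linarith [abs_sub (φ i) (φ j), hφ i, hφ j]

/-- Each entry of the softmax Jacobian applied to a vector bounded by `Δ` is at most `Δ / 2`. -/
lemma abs_softmax_jacobian_mulVec_le {ι : Type*} [Fintype ι] [DecidableEq ι] {p φ : ι → ℝ}
    {Δ : ℝ} (hp : ∀ i, 0 ≤ p i) (hsum : ∑ i, p i = 1) (hφ : ∀ i, |φ i| ≤ Δ) (i : ι) :
    |(Matrix.diagonal p - Matrix.vecMulVec p p).mulVec φ i| ≤ Δ / 2 := by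
  have hΔ : 0 ≤ Δ := (abs_nonneg _).trans (hφ i)
  rw [softmax_jacobian_mulVec_apply, abs_mul, abs_of_nonneg (hp i)]
  refine (mul_le_mul_of_nonneg_left (abs_sub_mean_le hp hsum hφ i) (hp i)).trans ?_
  nlinarith [mul_nonneg hΔ (sq_nonneg (2 * p i - 1))]

/-- **core bound in the Lipschitz constant of the 1-Wasserstein loss.**
For a probability vector `p ∈ ℝ^D`, `Δ ≥ 0`, and `φ ∈ ℝ^D` with `|φ_i| ≤ Δ` for all `i`,
`‖(diag(p) − p pᵀ) φ‖₂ ≤ Δ √D / 2`. -/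
theorem wasserstein_jacobian_vec_bound (D : ℕ) (p : Fin D → ℝ)
    (hp : ∀ i, 0 ≤ p i) (hsum : ∑ i, p i = 1)
    (Δ : ℝ) (hΔ : 0 ≤ Δ) (φ : Fin D → ℝ) (hφ : ∀ i, |φ i| ≤ Δ) :
    Real.sqrt (∑ i, ((Matrix.diagonal p - Matrix.vecMulVec p p).mulVec φ i) ^ 2)
      ≤ Δ * Real.sqrt D / 2 := by
  have h_sq : Δ * Real.sqrt D / 2 = Real.sqrt (∑ _i : Fin D, (Δ / 2) ^ 2) := by
    rw [Finset.sum_const, Finset.card_univ, Fintype.card_fin, nsmul_eq_mul,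
      Real.sqrt_mul (Nat.cast_nonneg D), Real.sqrt_sq (by positivity)]
    ring
  rw [h_sq]
  refine Real.sqrt_le_sqrt (Finset.sum_le_sum fun i _ => ?_)
  rw [← sq_abs]
  exact pow_le_pow_left₀ (abs_nonneg _) (abs_softmax_jacobian_mulVec_le hp hsum hφ i) 2
end

section
/- (Optimality of the sorting-based matching.) Let n be a positive integer and let a, b ∈ ℝ^n. Then the minimum over all permutations σ of {1,…,n} of Σ_{i=1}^n |a_i − b_{σ(i)}| equals Σ_{i=1}^n |a↓(i) − b↓(i)|, where a↓ and b↓ denote the vectors a and b sorted in descending order; that is, pairing the i-th largest entry of a with the i-th largest entry of b minimizes the total absolute-difference matching cost. -/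
/-- The crossing inequality: pairing in order costs at most as much as pairing crosswise. -/
theorem abs_sub_add_abs_sub_le_of_le {x y u v : ℝ} (hxy : x ≤ y) (huv : u ≤ v) :
    |x - u| + |y - v| ≤ |x - v| + |y - u| := by
  grind

/-- For monotone `f` and `g`, the identity minimizes the total absolute-difference cost. -/
theorem Monotone.sum_abs_sub_le_sum_abs_sub_comp_perm {n : ℕ} {f g : Fin n → ℝ}
    (hf : Monotone f) (hg : Monotone g) (σ : Equiv.Perm (Fin n)) :
    ∑ i, |f i - g i| ≤ ∑ i, |f i - g (σ i)| := by
  induction n with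
  | zero => simp
  | succ n ih =>
    obtain ⟨⟨p, e⟩, rfl⟩ := Equiv.Perm.decomposeFin.symm.surjective σ
    have htail := ih (f := f ∘ Fin.succ) (g := g ∘ Fin.succ)
      (hf.comp Fin.strictMono_succ.monotone) (hg.comp Fin.strictMono_succ.monotone) e
    simp only [Function.comp_apply] at htail
    simp only [Fin.sum_univ_succ, Equiv.Perm.decomposeFin_symm_apply_zero,
      Equiv.Perm.decomposeFin_symm_apply_succ]
    cases p using Fin.cases with
    | zero => simpa using htail
    | succ q =>
      have hrest : ∀ x ∈ Finset.univ.erase (e.symm q),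
          |f x.succ - g (Equiv.swap 0 q.succ (e x).succ)| = |f x.succ - g (e x).succ| := by
        intro x hx
        rw [Equiv.swap_apply_of_ne_of_ne (Fin.succ_ne_zero _)]
        simpa [Equiv.eq_symm_apply] using hx
      have hcross := abs_sub_add_abs_sub_le_of_le (hf (Fin.zero_le (e.symm q).succ))
        (hg (Fin.zero_le q.succ))
      refine (add_le_add_right htail _).trans ?_
      rw [← Finset.add_sum_erase _ (fun x => |f x.succ - g (e x).succ|)
          (Finset.mem_univ (e.symm q)),
        ← Finset.add_sum_erase _ (fun x => |f x.succ - g (Equiv.swap 0 q.succ (e x).succ)|)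
          (Finset.mem_univ (e.symm q)), Finset.sum_congr rfl hrest]
      simp only [Equiv.apply_symm_apply, Equiv.swap_apply_right]
      linarith


/-- **optimality of the sorting-based matching.**
For `a, b ∈ ℝⁿ`, the minimum over all permutations `σ` of `Σ_i |a_i − b_{σ(i)}|` equals
`Σ_i |a↓(i) − b↓(i)|`, where `a↓`, `b↓` are `a`, `b` sorted in descending order
(realized here by composing the monotone sorting permutation `Tuple.sort` with the
order-reversal `Fin.rev`). -/
theorem sorting_matching_optimal (n : ℕ) (hn : 0 < n) (a b : Fin n → ℝ) :
    (Finset.univ : Finset (Equiv.Perm (Fin n))).inf' Finset.univ_nonempty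
        (fun σ => ∑ i, |a i - b (σ i)|) =
      ∑ i : Fin n, |a (Tuple.sort a i.rev) - b (Tuple.sort b i.rev)| := by
  have hsum : ∑ i : Fin n, |a (Tuple.sort a i.rev) - b (Tuple.sort b i.rev)| =
      ∑ i, |a (Tuple.sort a i) - b (Tuple.sort b i)| :=
    Equiv.sum_comp Fin.revPerm fun i => |a (Tuple.sort a i) - b (Tuple.sort b i)|
  rw [hsum]
  apply le_antisymm
  · refine (Finset.inf'_le _
      (Finset.mem_univ ((Tuple.sort a).symm.trans (Tuple.sort b)))).trans_eq ?_
    rw [← Equiv.sum_comp (Tuple.sort a)]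
    simp
  · refine Finset.le_inf' _ _ fun σ _ => ?_
    rw [← Equiv.sum_comp (Tuple.sort a) fun i => |a i - b (σ i)|]
    simpa using (Tuple.monotone_sort a).sum_abs_sub_le_sum_abs_sub_comp_perm
      (Tuple.monotone_sort b) (((Tuple.sort a).trans σ).trans (Tuple.sort b).symm)
end
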